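/- Concentration of Hamming distance of one-bit measurements: for fixed unit vectors x, s in R^N and Φ an M×N matrix with i.i.d. standard Gaussian entries, with probability at least 1 - 2e^{-2ε²M}, the normalized Hamming distance between sign(Φx) and sign(Φs) differs from (1/π)arccos⟨x,s⟩ by at most ε. -/

import Mathlib

open MeasureTheory ProbabilityTheory

/-- The sign function used in 1-bit compressive sensing: `1` if positive, `-1` otherwise. -/
noncomputable def rsign (t : ℝ) : ℝ := if 0 < t then 1 else -1

/-- A linear form in a standard Gaussian vector is a centered Gaussian. -/
lemma map_pi_gaussianReal_sum_mul {ι : Type*} [Fintype ι] (y : ι → ℝ) :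
    (Measure.pi fun _ : ι => gaussianReal 0 1).map (fun φ => ∑ i, φ i * y i) =
      gaussianReal 0 (∑ i, y i ^ 2).toNNReal := by
  apply Measure.ext_of_charFun
  have hind : iIndepFun (fun i (φ : ι → ℝ) => φ i * y i)
      (Measure.pi fun _ : ι => gaussianReal 0 1) :=
    iIndepFun_pi (X := fun i t => t * y i) fun i => by fun_prop
  rw [hind.charFun_map_fun_sum_eq_prod fun i => Measurable.aemeasurable (by fun_prop)]
  ext t
  have hmap (i : ι) : (Measure.pi fun _ : ι => gaussianReal 0 1).map (fun φ => φ i * y i) =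
      gaussianReal 0 (y i ^ 2).toNNReal := by
    have h := gaussianReal_map_mul_const (μ := 0) (v := 1) (y i)
    rw [mul_zero, mul_one, ← (measurePreserving_eval (fun _ : ι => gaussianReal 0 1) i).map_eq,
      Measure.map_map (by fun_prop) (by fun_prop)] at h
    rwa [Real.toNNReal_of_nonneg (sq_nonneg _)]
  have hnn : 0 ≤ ∑ i, y i ^ 2 := Finset.sum_nonneg fun i _ => sq_nonneg _
  simp only [Finset.prod_apply, hmap, charFun_gaussianReal, ← Complex.exp_sum]
  congr 1
  simp only [Complex.ofReal_zero, mul_zero, zero_mul, zero_sub, Finset.sum_neg_distrib,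
    Real.coe_toNNReal _ hnn, Real.coe_toNNReal _ (sq_nonneg _), Complex.ofReal_sum,
    Finset.sum_mul, Finset.sum_div]

lemma map_pi_gaussianReal_combination {ι : Type*} [Fintype ι] (u v : ι → ℝ) (p q : ℝ) :
    (Measure.pi fun _ : ι => gaussianReal 0 1).map
        (fun φ => p * ∑ i, φ i * u i + q * ∑ i, φ i * v i) =
      gaussianReal 0 (p ^ 2 * ∑ i, u i ^ 2 + q ^ 2 * ∑ i, v i ^ 2
        + 2 * p * q * ∑ i, u i * v i).toNNReal := by
  convert! map_pi_gaussianReal_sum_mul fun i => p * u i + q * v i using 2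
  · ext φ
    simp only [Finset.mul_sum, ← Finset.sum_add_distrib]
    exact Finset.sum_congr rfl fun i _ => by ring
  · congr 1
    simp only [Finset.mul_sum, ← Finset.sum_add_distrib]
    exact Finset.sum_congr rfl fun i _ => by ring

/-- The joint law of two linear forms in a standard Gaussian vector depends only on the
Gram matrix of their coefficient vectors. -/
lemma map_pi_gaussianReal_pair_eq {ι κ : Type*} [Fintype ι] [Fintype κ]
    (x s : ι → ℝ) (y t : κ → ℝ) (hxx : ∑ i, x i ^ 2 = ∑ k, y k ^ 2)
    (hss : ∑ i, s i ^ 2 = ∑ k, t k ^ 2) (hxs : ∑ i, x i * s i = ∑ k, y k * t k) :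
    (Measure.pi fun _ : ι => gaussianReal 0 1).map
        (fun φ => (∑ i, φ i * x i, ∑ i, φ i * s i)) =
      (Measure.pi fun _ : κ => gaussianReal 0 1).map
        (fun φ => (∑ k, φ k * y k, ∑ k, φ k * t k)) := by
  apply Measure.ext_of_charFunDual
  ext L
  obtain ⟨p, q, hL⟩ : ∃ p q : ℝ, ∀ z : ℝ × ℝ, L z = p * z.1 + q * z.2 := by
    refine ⟨L (1, 0), L (0, 1), fun z => ?_⟩
    have hz : z = z.1 • ((1 : ℝ), (0 : ℝ)) + z.2 • ((0 : ℝ), (1 : ℝ)) := by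
      ext <;> simp
    conv_lhs => rw [hz, map_add, map_smul, map_smul, smul_eq_mul, smul_eq_mul]
    ring
  rw [charFunDual_eq_charFun_map_one, charFunDual_eq_charFun_map_one, Measure.map_map (by fun_prop)
    (by fun_prop), Measure.map_map (by fun_prop) (by fun_prop)]
  simp only [Function.comp_def, hL]
  rw [map_pi_gaussianReal_combination, map_pi_gaussianReal_combination, hxx, hss, hxs]

/-- The standard Gaussian measure of a planar cone is proportional to its aperture. -/
lemma gaussianReal_prod_cone {E : Set (ℝ × ℝ)} {T : Set ℝ} (hE : MeasurableSet E)
    (hT : MeasurableSet T) (hET : ∀ r > 0, ∀ t ∈ Set.Ioo (-Real.pi) Real.pi,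
      (r * Real.cos t, r * Real.sin t) ∈ E ↔ t ∈ T) :
    ((gaussianReal 0 1).prod (gaussianReal 0 1)) E * ENNReal.ofReal (2 * Real.pi) =
      volume (T ∩ Set.Ioo (-Real.pi) Real.pi) := by
  obtain ⟨C, hC⟩ : ∃ C : ENNReal, ∀ (E : Set (ℝ × ℝ)) (T : Set ℝ), MeasurableSet E →
      MeasurableSet T → (∀ r > 0, ∀ t ∈ Set.Ioo (-Real.pi) Real.pi,
        (r * Real.cos t, r * Real.sin t) ∈ E ↔ t ∈ T) →
      ((gaussianReal 0 1).prod (gaussianReal 0 1)) E =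
        C * volume (T ∩ Set.Ioo (-Real.pi) Real.pi) := by
    let g : ℝ → ENNReal := fun r =>
      ENNReal.ofReal r * ENNReal.ofReal ((2 * Real.pi)⁻¹ * Real.exp (-r ^ 2 / 2))
    have hg : Measurable g := by fun_prop
    refine ⟨∫⁻ r in Set.Ioi 0, g r, fun E T hE hT hET => ?_⟩
    rw [gaussianReal_of_var_ne_zero _ one_ne_zero,
      prod_withDensity (measurable_gaussianPDF _ _) (measurable_gaussianPDF _ _),
      ← Measure.volume_eq_prod, withDensity_apply _ hE, ← lintegral_indicator hE,
      ← lintegral_comp_polarCoord_symm]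
    have hprod : ∫⁻ p in Set.Ioi (0 : ℝ) ×ˢ Set.Ioo (-Real.pi) Real.pi,
        g p.1 * T.indicator 1 p.2 =
        (∫⁻ r in Set.Ioi 0, g r) * volume (T ∩ Set.Ioo (-Real.pi) Real.pi) := by
      rw [Measure.volume_eq_prod, ← Measure.prod_restrict,
        lintegral_prod_mul hg.aemeasurable (measurable_one.indicator hT).aemeasurable,
        lintegral_indicator_one hT, Measure.restrict_apply hT]
    rw [← hprod]
    refine setLIntegral_congr_fun (measurableSet_Ioi.prod measurableSet_Ioo) ?_
    rintro ⟨r, t⟩ ⟨hr, ht⟩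
    have hmem := hET r hr t ht
    simp only [polarCoord_symm_apply, smul_eq_mul, g]
    by_cases h : t ∈ T
    · rw [Set.indicator_of_mem (hmem.2 h), Set.indicator_of_mem h, Pi.one_apply, mul_one]
      congr 1
      rw [gaussianPDF, gaussianPDF, ← ENNReal.ofReal_mul (gaussianPDFReal_nonneg _ _ _)]
      congr 1
      have hpi : (0 : ℝ) ≤ 2 * Real.pi := by positivity
      have hsq := Real.mul_self_sqrt hpi
      simp only [gaussianPDFReal, NNReal.coe_one, mul_one, sub_zero]
      rw [mul_mul_mul_comm, ← mul_inv, hsq, ← Real.exp_add]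
      congr 2
      linear_combination (-r ^ 2 / 2) * Real.sin_sq_add_cos_sq t
    · rw [Set.indicator_of_notMem (hmem.not.2 h), Set.indicator_of_notMem h, mul_zero, mul_zero]
  have huniv := hC Set.univ Set.univ .univ .univ (by simp)
  rw [measure_univ, Set.univ_inter, Real.volume_Ioo, sub_neg_eq_add, ← two_mul] at huniv
  rw [hC E T hE hT hET, mul_right_comm, ← huniv, one_mul]

lemma volume_inter_Ioo_of_subset_of_subset {T : Set ℝ} {θ : ℝ} (hθ : θ ≤ Real.pi)
    (hsub : Set.Ioo (-(Real.pi / 2)) (θ - Real.pi / 2) ⊆ T)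
    (hsup : T ∩ Set.Ioo (-Real.pi) Real.pi ⊆ Set.Icc (-(Real.pi / 2)) (θ - Real.pi / 2)) :
    volume (T ∩ Set.Ioo (-Real.pi) Real.pi) = ENNReal.ofReal θ := by
  have hpi := Real.pi_pos
  apply le_antisymm
  · refine (measure_mono hsup).trans_eq ?_
    rw [Real.volume_Icc]; congr 1; ring
  · refine Eq.trans_le ?_ (measure_mono (Set.subset_inter hsub
      (Set.Ioo_subset_Ioo (by linarith) (by linarith))))
    rw [Real.volume_Ioo]; congr 1; ring

lemma mem_Icc_of_cos_nonneg {t : ℝ} (ht : t ∈ Set.Ioo (-Real.pi) Real.pi) (h : 0 ≤ Real.cos t) :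
    t ∈ Set.Icc (-(Real.pi / 2)) (Real.pi / 2) := by
  obtain ⟨h1, h2⟩ := ht
  constructor
  · by_contra! hlt
    have := Real.cos_neg_of_pi_div_two_lt_of_lt (x := -t) (by linarith) (by linarith)
    rw [Real.cos_neg] at this
    linarith
  · by_contra! hlt
    linarith [Real.cos_neg_of_pi_div_two_lt_of_lt hlt (by linarith)]

/-- Two half-planes at angle `θ` disagree on a cone of Gaussian measure `θ / π`. -/
lemma gaussianReal_prod_sign_ne {θ : ℝ} (hθ0 : 0 ≤ θ) (hθ : θ ≤ Real.pi) :
    ((gaussianReal 0 1).prod (gaussianReal 0 1))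
      {z | rsign z.1 ≠ rsign (z.1 * Real.cos θ + z.2 * Real.sin θ)} =
      ENNReal.ofReal (θ / Real.pi) := by
  have hpi := Real.pi_pos
  set γ := (gaussianReal 0 1).prod (gaussianReal 0 1) with hγ
  let f : ℝ × ℝ → ℝ := fun z => z.1 * Real.cos θ + z.2 * Real.sin θ
  have hf : Measurable f := by fun_prop
  have hfpolar (r t : ℝ) : f (r * Real.cos t, r * Real.sin t) = r * Real.cos (t - θ) := by
    simp only [f, Real.cos_sub]; ring
  have hcos : Measurable fun t => Real.cos (t - θ) := by fun_prop
  have hmA : MeasurableSet {z : ℝ × ℝ | 0 < z.1 ∧ f z ≤ 0} :=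
    (measurableSet_lt measurable_const measurable_fst).inter (measurableSet_le hf measurable_const)
  have hmB : MeasurableSet {z : ℝ × ℝ | z.1 ≤ 0 ∧ 0 < f z} :=
    (measurableSet_le measurable_fst measurable_const).inter (measurableSet_lt measurable_const hf)
  have hmB' : MeasurableSet {z : ℝ × ℝ | 0 ≤ z.1 ∧ f z < 0} :=
    (measurableSet_le measurable_const measurable_fst).inter (measurableSet_lt hf measurable_const)
  have hcosneg {t : ℝ} (ht : t ∈ Set.Ioo (-(Real.pi / 2)) (θ - Real.pi / 2)) :
      Real.cos (t - θ) < 0 := by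
    rw [← Real.cos_neg]
    exact Real.cos_neg_of_pi_div_two_lt_of_lt (by linarith [ht.2]) (by linarith [ht.1])
  have hcospos {t : ℝ} (ht : t ∈ Set.Ioo (-(Real.pi / 2)) (θ - Real.pi / 2)) :
      0 < Real.cos t :=
    Real.cos_pos_of_mem_Ioo ⟨ht.1, by linarith [ht.2]⟩
  have hle {t : ℝ} (ht : t ∈ Set.Ioo (-Real.pi) Real.pi) (h1 : 0 ≤ Real.cos t)
      (h2 : Real.cos (t - θ) ≤ 0) (h3 : Real.cos (t - θ) < Real.cos t) :
      t ∈ Set.Icc (-(Real.pi / 2)) (θ - Real.pi / 2) := by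
    have hmem := mem_Icc_of_cos_nonneg ht h1
    refine ⟨hmem.1, ?_⟩
    by_contra! hlt
    linarith [Real.cos_pos_of_mem_Ioo (x := t - θ) ⟨by linarith, by
      rcases hθ0.eq_or_lt with rfl | h0
      · simp at h3
      · linarith [hmem.2]⟩]
  have hA : γ {z | 0 < z.1 ∧ f z ≤ 0} * ENNReal.ofReal (2 * Real.pi) = ENNReal.ofReal θ := by
    rw [hγ, gaussianReal_prod_cone (T := {t | 0 < Real.cos t ∧ Real.cos (t - θ) ≤ 0})
      hmA ((measurableSet_lt measurable_const Real.measurable_cos).inter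
        (measurableSet_le hcos measurable_const))]
    · exact volume_inter_Ioo_of_subset_of_subset hθ
        (fun t ht => ⟨hcospos ht, (hcosneg ht).le⟩) fun t ht => hle ht.2 ht.1.1.le ht.1.2
          (ht.1.2.trans_lt ht.1.1)
    · intro r hr t _
      simp [hfpolar, hr, mul_nonpos_iff, hr.le, hr.not_ge]
  have hB' : γ {z | 0 ≤ z.1 ∧ f z < 0} * ENNReal.ofReal (2 * Real.pi) = ENNReal.ofReal θ := by
    rw [hγ, gaussianReal_prod_cone (T := {t | 0 ≤ Real.cos t ∧ Real.cos (t - θ) < 0})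
      hmB' ((measurableSet_le measurable_const Real.measurable_cos).inter
        (measurableSet_lt hcos measurable_const))]
    · exact volume_inter_Ioo_of_subset_of_subset hθ
        (fun t ht => ⟨(hcospos ht).le, hcosneg ht⟩) fun t ht => hle ht.2 ht.1.1 ht.1.2.le
          (ht.1.2.trans_le ht.1.1)
    · intro r hr t _
      simp [hfpolar, hr, mul_neg_iff, hr.not_gt]
  have hneg : MeasurePreserving (fun t : ℝ => -t) (gaussianReal 0 1) (gaussianReal 0 1) :=
    ⟨measurable_neg, by simp [gaussianReal_map_neg]⟩
  have hB : γ {z | z.1 ≤ 0 ∧ 0 < f z} * ENNReal.ofReal (2 * Real.pi) = ENNReal.ofReal θ := by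
    rw [← hB', ← (hneg.prod hneg).measure_preimage hmB.nullMeasurableSet]
    congr 2
    ext z
    have : f (Prod.map (fun t => -t) (fun t => -t) z) = -f z := by
      simp only [f, Prod.map_fst, Prod.map_snd]; ring
    simp [this]
  have hunion : {z : ℝ × ℝ | rsign z.1 ≠ rsign (z.1 * Real.cos θ + z.2 * Real.sin θ)} =
      {z | 0 < z.1 ∧ f z ≤ 0} ∪ {z | z.1 ≤ 0 ∧ 0 < f z} := by
    ext z
    simp only [rsign, Set.mem_ofPred_eq, Set.mem_union, f]
    split_ifs <;> norm_num <;> grind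
  rw [hunion, measure_union _ hmB]
  · have h2 : ENNReal.ofReal (2 * Real.pi) ≠ 0 := by simp [hpi]
    rw [← ENNReal.mul_left_inj h2 ENNReal.ofReal_ne_top, add_mul, hA, hB,
      ← ENNReal.ofReal_add hθ0 hθ0, ← ENNReal.ofReal_mul (by positivity)]
    congr 1
    field_simp
    ring
  · exact Set.disjoint_left.2 fun z h1 h2 => h1.1.not_ge h2.1

lemma measurable_rsign : Measurable rsign :=
  Measurable.ite measurableSet_Ioi measurable_const measurable_const

lemma measurableSet_rsign_ne {ι : Type*} [Fintype ι] (x s : ι → ℝ) :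
    MeasurableSet {φ : ι → ℝ | rsign (∑ j, φ j * x j) ≠ rsign (∑ j, φ j * s j)} :=
  (measurableSet_eq_fun (measurable_rsign.comp (by fun_prop))
    (measurable_rsign.comp (by fun_prop))).compl

/-- A standard Gaussian vector separates two unit vectors with probability equal to their
normalized angle. -/
lemma pi_gaussianReal_rsign_ne {ι : Type*} [Fintype ι] (x s : ι → ℝ)
    (hx : ∑ i, x i ^ 2 = 1) (hs : ∑ i, s i ^ 2 = 1) :
    (Measure.pi fun _ : ι => gaussianReal 0 1)
      {φ | rsign (∑ j, φ j * x j) ≠ rsign (∑ j, φ j * s j)} =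
      ENNReal.ofReal (Real.arccos (∑ i, x i * s i) / Real.pi) := by
  have hcs := Finset.sum_mul_sq_le_sq_mul_sq Finset.univ x s
  rw [hx, hs, one_mul, sq_le_one_iff_abs_le_one, abs_le] at hcs
  set θ := Real.arccos (∑ i, x i * s i) with hθ
  have hcos : Real.cos θ = ∑ i, x i * s i := Real.cos_arccos hcs.1 hcs.2
  have hlaw := map_pi_gaussianReal_pair_eq x s ![1, 0] ![Real.cos θ, Real.sin θ]
    (by simp [hx]) (by simp [hs]) (by simp [hcos])
  have hms : MeasurableSet {z : ℝ × ℝ | rsign z.1 ≠ rsign z.2} :=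
    (measurableSet_eq_fun (measurable_rsign.comp measurable_fst)
      (measurable_rsign.comp measurable_snd)).compl
  have hm := congrArg (fun μ => μ {z : ℝ × ℝ | rsign z.1 ≠ rsign z.2}) hlaw
  rw [Measure.map_apply (by fun_prop) hms, Measure.map_apply (by fun_prop) hms] at hm
  refine hm.trans ?_
  rw [← gaussianReal_prod_sign_ne (Real.arccos_nonneg _) (Real.arccos_le_pi _), ← hθ,
    ← (measurePreserving_piFinTwo fun _ : Fin 2 => gaussianReal 0 1).measure_preimage_equiv]
  congr 1
  ext φ
  simp [MeasurableEquiv.piFinTwo]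

/-- Two-sided Hoeffding bound for the frequency of an event in independent trials. -/
lemma pi_frequency_concentration {Ω : Type*} [MeasurableSpace Ω] (P : Measure Ω)
    [IsProbabilityMeasure P] {B : Set Ω} (hB : MeasurableSet B) {M : ℕ} (hM : 0 < M) {ε : ℝ}
    (hε : 0 < ε) :
    1 - ENNReal.ofReal (2 * Real.exp (-2 * ε ^ 2 * M)) ≤
      (Measure.pi fun _ : Fin M => P)
        {ω | |(({i : Fin M | ω i ∈ B}.ncard : ℝ) / M) - P.real B| ≤ ε} := by
  classical
  set Q := Measure.pi fun _ : Fin M => P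
  have hM' : (0 : ℝ) < M := by exact_mod_cast hM
  let Z : Ω → ℝ := B.indicator 1
  have hZ : Measurable Z := measurable_one.indicator hB
  let Y : Fin M → (Fin M → Ω) → ℝ := fun i ω => Z (ω i)
  have hmean (i : Fin M) : Q[Y i] = P.real B := by
    have h := integral_map (μ := Q) (φ := fun ω => ω i) (f := Z)
      (measurable_pi_apply i).aemeasurable
      hZ.aestronglyMeasurable
    rw [(measurePreserving_eval (fun _ : Fin M => P) i).map_eq] at h
    rw [← h, integral_indicator_one hB]
  have hsub (i : Fin M) : HasSubgaussianMGF (fun ω => Y i ω - P.real B) (1 / 4) Q := by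
    have h := hasSubgaussianMGF_of_mem_Icc (μ := Q) (X := Y i) (a := 0) (b := 1)
      (by fun_prop) (ae_of_all _ fun ω => by
        simp only [Y, Z, Set.indicator_apply]; split_ifs <;> simp)
    rw [hmean] at h
    convert! h using 1
    norm_num
  have hind : iIndepFun (fun i ω => Y i ω - P.real B) Q :=
    iIndepFun_pi (X := fun _ ω => Z ω - P.real B) fun i => by fun_prop
  have hexp : Real.exp (-(ε * M) ^ 2 / (2 * ∑ _i : Fin M, ((1 / 4 : NNReal) : ℝ))) =
      Real.exp (-2 * ε ^ 2 * M) := by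
    congr 1
    simp
    field_simp
    ring
  have hup := HasSubgaussianMGF.measure_sum_ge_le_of_iIndepFun hind (s := Finset.univ)
    (fun i _ => hsub i) (ε := ε * M) (by positivity)
  have hlow := HasSubgaussianMGF.measure_sum_ge_le_of_iIndepFun
    (X := fun i ω => -(Y i ω - P.real B))
    (hind.comp (fun _ t => -t) fun _ => measurable_neg) (s := Finset.univ)
    (fun i _ => (hsub i).neg) (ε := ε * M) (by positivity)
  push_cast at hup hlow hexp
  rw [hexp] at hup hlow
  set G := {ω : Fin M → Ω | |(({i : Fin M | ω i ∈ B}.ncard : ℝ) / M) - P.real B| ≤ ε}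
  have hsum (ω : Fin M → Ω) : ∑ i, (Y i ω - P.real B) =
      ((({i : Fin M | ω i ∈ B}.ncard : ℝ) / M) - P.real B) * M := by
    simp only [Y, Z, Set.indicator_apply, Finset.sum_sub_distrib, Pi.one_apply,
      Finset.sum_boole, Set.ncard_eq_toFinset_card']
    simp
    field_simp
  have hcompl : Gᶜ ⊆ {ω | ε * M ≤ ∑ i, (Y i ω - P.real B)} ∪
      {ω | ε * M ≤ ∑ i, -(Y i ω - P.real B)} := by
    intro ω hω
    simp only [G, Set.mem_compl_iff, Set.mem_ofPred_eq, not_le, lt_abs] at hω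
    simp only [Set.mem_union, Set.mem_ofPred_eq, Finset.sum_neg_distrib, hsum, ← neg_mul,
      mul_le_mul_iff_left₀ hM']
    exact hω.imp le_of_lt le_of_lt
  have hbound : Q Gᶜ ≤ ENNReal.ofReal (2 * Real.exp (-2 * ε ^ 2 * M)) := by
    rw [← ofReal_measureReal]
    apply ENNReal.ofReal_le_ofReal
    have h1 := measureReal_mono (μ := Q) hcompl
    have h2 := measureReal_union_le (μ := Q) {ω | ε * M ≤ ∑ i, (Y i ω - P.real B)}
      {ω | ε * M ≤ ∑ i, -(Y i ω - P.real B)}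
    linarith
  rw [tsub_le_iff_right]
  calc (1 : ENNReal) = Q (G ∪ Gᶜ) := by rw [Set.union_compl_self, measure_univ]
    _ ≤ Q G + Q Gᶜ := measure_union_le _ _
    _ ≤ _ := by gcongr

theorem hamming_concentration (N M : ℕ) (hM : 0 < M) (ε : ℝ) (hε : 0 < ε)
    (x s : Fin N → ℝ) (hx : ∑ i, x i ^ 2 = 1) (hs : ∑ i, s i ^ 2 = 1) :
    1 - ENNReal.ofReal (2 * Real.exp (-2 * ε ^ 2 * M)) ≤
      (Measure.pi fun _ : Fin M => Measure.pi fun _ : Fin N => gaussianReal 0 1)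
        {Φ : Fin M → Fin N → ℝ |
          |(({i : Fin M | rsign (∑ j, Φ i j * x j) ≠ rsign (∑ j, Φ i j * s j)}.ncard : ℝ) / M)
              - Real.arccos (∑ i, x i * s i) / Real.pi| ≤ ε} := by
  have h := pi_frequency_concentration (Measure.pi fun _ : Fin N => gaussianReal 0 1)
    (measurableSet_rsign_ne x s) hM hε
  rwa [measureReal_def, pi_gaussianReal_rsign_ne x s hx hs, ENNReal.toReal_ofReal
    (div_nonneg (Real.arccos_nonneg _) Real.pi_pos.le)] at h
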